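/- Let k ≥ 2 be an integer, α, β ∈ ℝ∖ℤ, and x ∈ ℂ with Re(x) > 0 (so x+1 and (x+1)/x also have positive real part). Then 𝓕_k(x; α, β) − 𝓕_k(x+1; α+β, β) + (−x)^{k−2} · 𝓕_k((x+1)/x; α+β, α) = (1/x) · Li_k(e^{2πiα}) − ((−x)^{k−1}/(x+1)) · Li_k(e^{2πi(α+β)}) + Σ_{r=1}^{k−1} (−x)^{r−1} · Li_{r,k−r}(e^{2πiβ}, e^{2πiα}). -/

import Mathlib

open Complex MeasureTheory Filter Topology Set Asymptotics

noncomputable section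

/-- `e2pi θ = e^{2πiθ}`. -/
def e2pi (θ : ℝ) : ℂ := Complex.exp (2 * Real.pi * Complex.I * θ)

/-- Polylogarithm of integer order: `Li 0 z = z/(1-z)`, `Li 1 z = -Log(1-z)`,
`Li m z = ∑_{n≥1} z^n/n^m` for `m ≥ 2`. -/
def Li : ℕ → ℂ → ℂ
  | 0, z => z / (1 - z)
  | 1, z => -Complex.log (1 - z)
  | (m+2), z => ∑' n : ℕ, z ^ (n+1) / ((n+1 : ℕ) : ℂ) ^ (m+2)

/-- The double polylogarithm `Li_{a,b}(z₁,z₂) = ∑_{0<p<q} z₁^p z₂^q/(p^a q^b)`, as an iterated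
sum whose inner series is summed as the limit of its partial sums. -/
def Li2 (a b : ℕ) (z₁ z₂ : ℂ) : ℂ :=
  ∑' p : ℕ, (z₁ ^ (p + 1) / ((p + 1 : ℕ) : ℂ) ^ a) *
    limUnder atTop (fun N : ℕ => ∑ q ∈ Finset.Icc (p + 2) N, z₂ ^ q / ((q : ℕ) : ℂ) ^ b)

/-- The higher Herglotz–Zagier–Novikov function
`𝓕_k(x; α, β) = ∫₀^∞ Li_{k-1}(e^{-xt} e^{2πiα}) / (1 - e^{-t} e^{2πiβ}) dt`. -/
def HHZN (k : ℕ) (x : ℂ) (α β : ℝ) : ℂ :=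
  ∫ t in Set.Ioi (0:ℝ),
    Li (k-1) (Complex.exp (-x * t) * e2pi α) / (1 - Complex.exp (-(t:ℂ)) * e2pi β)

/-- auxiliary integral -/
def JJ (w b : ℂ) : ℂ := ∫ t in Set.Ioi (0:ℝ), Complex.exp (-w * t) / (1 - Complex.exp (-(t:ℂ)) * b)

theorem e2pi_norm (θ : ℝ) : ‖e2pi θ‖ = 1 := by
  unfold e2pi
  rw [Complex.norm_exp]
  simp

theorem e2pi_add (θ φ : ℝ) : e2pi (θ + φ) = e2pi θ * e2pi φ := by
  unfold e2pi
  rw [← Complex.exp_add]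
  push_cast
  ring_nf

theorem e2pi_ne_one (θ : ℝ) (h : ∀ n : ℤ, θ ≠ n) : e2pi θ ≠ 1 := by
  unfold e2pi
  rw [Ne, Complex.exp_eq_one_iff]
  rintro ⟨n, hn⟩
  apply h n
  have h2 : (2 * Real.pi * Complex.I : ℂ) ≠ 0 := Complex.two_pi_I_ne_zero
  have : (θ : ℂ) = n := by
    apply mul_left_cancel₀ h2
    rw [hn]; ring
  exact_mod_cast this

theorem den_bound (b : ℂ) (hb : ‖b‖ = 1) (hb1 : b ≠ 1) :
    ∃ C : ℝ, 0 < C ∧ ∀ t : ℝ, 0 < t → (1 - Complex.exp (-(t:ℂ)) * b) ≠ 0 ∧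
      ‖(1 - Complex.exp (-(t:ℂ)) * b)⁻¹‖ ≤ C := by
  have hne : ∀ u ∈ Set.Icc (0:ℝ) 1, (1 - (u:ℂ) * b) ≠ 0 := by
    intro u hu h
    have h1 : (u:ℂ) * b = 1 := (sub_eq_zero.mp h).symm
    have h2 : ‖(u:ℂ) * b‖ = 1 := by rw [h1]; simp
    rw [norm_mul, hb, mul_one, Complex.norm_real, Real.norm_of_nonneg hu.1] at h2
    rw [h2] at h1
    exact hb1 (by simpa using h1)
  have hc : ContinuousOn (fun u : ℝ => ‖(1 - (u:ℂ) * b)‖) (Set.Icc (0:ℝ) 1) := by fun_prop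
  obtain ⟨u0, hu0, hmin⟩ := isCompact_Icc.exists_isMinOn ⟨0, by simp⟩ hc
  have hpos : 0 < ‖(1 - (u0:ℂ) * b)‖ := norm_pos_iff.mpr (hne u0 hu0)
  refine ⟨‖(1 - (u0:ℂ) * b)‖⁻¹, inv_pos.mpr hpos, ?_⟩
  intro t ht
  have hmem : Real.exp (-t) ∈ Set.Icc (0:ℝ) 1 := ⟨(Real.exp_pos _).le, by simpa using ht.le⟩
  have he : Complex.exp (-(t:ℂ)) = ((Real.exp (-t) : ℝ) : ℂ) := by push_cast; rfl
  rw [he]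
  refine ⟨hne _ hmem, ?_⟩
  rw [norm_inv]
  exact inv_anti₀ hpos (hmin hmem)

theorem JJ_integrable (w b : ℂ) (hw : 0 < w.re) (hb : ‖b‖ = 1) (hb1 : b ≠ 1) :
    IntegrableOn (fun t : ℝ => Complex.exp (-w * t) / (1 - Complex.exp (-(t:ℂ)) * b))
      (Set.Ioi (0:ℝ)) := by
  obtain ⟨C, hC, hCb⟩ := den_bound b hb hb1
  have h1 : IntegrableOn (fun t : ℝ => Complex.exp (-w * t)) (Set.Ioi 0) :=
    integrableOn_exp_mul_complex_Ioi (by simpa using hw) 0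
  have h2 : IntegrableOn (fun t : ℝ => (1 - Complex.exp (-(t:ℂ)) * b)⁻¹ * Complex.exp (-w * t))
      (Set.Ioi (0:ℝ)) := by
    apply Integrable.bdd_mul (c := C) h1
    · apply Measurable.aestronglyMeasurable
      fun_prop
    · filter_upwards [ae_restrict_mem measurableSet_Ioi] with t ht
      exact (hCb t ht).2
  refine h2.congr (Filter.Eventually.of_forall fun t => ?_)
  simp only [div_eq_mul_inv]
  ring

theorem norm_bound (b : ℂ) (hb : ‖b‖ = 1) (hb1 : b ≠ 1) :
    ∃ C : ℝ, 0 < C ∧ ∀ w : ℂ, 0 < w.re →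
      (∫ t in Set.Ioi (0:ℝ), ‖Complex.exp (-w * t) / (1 - Complex.exp (-(t:ℂ)) * b)‖) ≤ C / w.re ∧
      ‖JJ w b‖ ≤ C / w.re := by
  obtain ⟨C, hC, hCb⟩ := den_bound b hb hb1
  refine ⟨C, hC, fun w hw => ?_⟩
  have key : (∫ t in Set.Ioi (0:ℝ), ‖Complex.exp (-w * t) / (1 - Complex.exp (-(t:ℂ)) * b)‖)
      ≤ C / w.re := by
    have hi : IntegrableOn (fun t : ℝ => C * Real.exp (-w.re * t)) (Set.Ioi 0) :=
      (integrableOn_exp_mul_Ioi (by linarith) 0).const_mul C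
    calc _ ≤ ∫ t in Set.Ioi (0:ℝ), C * Real.exp (-w.re * t) := by
          apply setIntegral_mono_on (JJ_integrable w b hw hb hb1).norm hi measurableSet_Ioi
          intro t ht
          rw [div_eq_mul_inv, norm_mul, mul_comm, Complex.norm_exp]
          have : (-w * (t:ℂ)).re = -w.re * t := by simp
          rw [this]
          exact mul_le_mul_of_nonneg_right (hCb t ht).2 (Real.exp_pos _).le
      _ = C / w.re := by
          rw [MeasureTheory.integral_const_mul, integral_exp_mul_Ioi (by linarith)]
          simp [div_eq_mul_inv]
  exact ⟨key, (norm_integral_le_integral_norm _).trans key⟩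

theorem JJ_rec (w b : ℂ) (hw : 0 < w.re) (hb : ‖b‖ = 1) (hb1 : b ≠ 1) :
    JJ w b = 1 / w + b * JJ (w + 1) b := by
  obtain ⟨C, hC, hCb⟩ := den_bound b hb hb1
  have h0 : (∫ t in Set.Ioi (0:ℝ), Complex.exp (-w * t)) = 1 / w := by
    rw [integral_exp_mul_complex_Ioi (by simpa using hw)]
    simp
  rw [← h0]
  unfold JJ
  rw [← MeasureTheory.integral_const_mul, ← integral_add
    (integrableOn_exp_mul_complex_Ioi (by simpa using hw) 0)
    ((JJ_integrable (w+1) b (by simp; linarith) hb hb1).const_mul b)]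
  apply setIntegral_congr_fun measurableSet_Ioi
  intro t ht
  have hne := (hCb t ht).1
  have he : Complex.exp (-(w+1) * t) = Complex.exp (-w * t) * Complex.exp (-(t:ℂ)) := by
    rw [← Complex.exp_add]; ring_nf
  simp only [he]
  field_simp
  ring

theorem JJ_sum (w b : ℂ) (hw : 0 < w.re) (hb : ‖b‖ = 1) (hb1 : b ≠ 1) (N : ℕ) :
    JJ w b = ∑ q ∈ Finset.range N, b ^ q / (w + q) + b ^ N * JJ (w + N) b := by
  induction N with
  | zero => simp
  | succ n ih =>
    rw [ih, Finset.sum_range_succ, JJ_rec (w + n) b (by simp; positivity) hb hb1]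
    push_cast
    rw [add_assoc w n 1]
    ring

theorem Li_hasSum (m : ℕ) (z : ℂ) (hz : ‖z‖ < 1) :
    HasSum (fun n : ℕ => z ^ (n+1) / ((n+1 : ℕ) : ℂ) ^ (m+1)) (Li (m+1) z) := by
  rcases m with _ | m
  · have h := Complex.hasSum_taylorSeries_neg_log hz
    have := (hasSum_nat_add_iff' (f := fun n : ℕ => z ^ n / (n:ℂ)) 1).mpr h
    simpa [Li] using this
  · unfold Li
    apply Summable.hasSum
    apply Summable.of_norm_bounded (g := fun n : ℕ => ‖z‖ ^ n)
      (summable_geometric_of_lt_one (norm_nonneg _) hz)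
    intro n
    rw [norm_div, norm_pow, norm_pow, Complex.norm_natCast]
    have h1 : (1:ℝ) ≤ ((n+1 : ℕ):ℝ) ^ (m+2) := one_le_pow₀ (by push_cast; linarith [Nat.cast_nonneg (α := ℝ) n])
    calc ‖z‖ ^ (n+1) / ((n+1 : ℕ):ℝ) ^ (m+2) ≤ ‖z‖ ^ (n+1) := div_le_self (by positivity) h1
      _ ≤ ‖z‖ ^ n := pow_le_pow_of_le_one (norm_nonneg _) hz.le (Nat.le_succ n)

theorem summable_aux (m : ℕ) (K : ℝ) : Summable (fun n : ℕ => K / ((n+1 : ℕ) : ℝ) ^ (m+2)) := by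
  have h := (summable_nat_add_iff 1).mpr (Real.summable_one_div_nat_pow (p := m+2).mpr (by omega))
  have := h.mul_left K
  refine this.congr fun n => ?_
  rw [mul_one_div]

theorem HHZN_hasSum (m : ℕ) (x : ℂ) (hx : 0 < x.re) (α β : ℝ) (hβ : ∀ n : ℤ, β ≠ n) :
    HasSum (fun n : ℕ => e2pi α ^ (n+1) / ((n+1 : ℕ) : ℂ) ^ (m+1) *
      JJ (((n+1 : ℕ) : ℂ) * x) (e2pi β)) (HHZN (m+2) x α β) := by
  have hb := e2pi_norm β
  have hb1 := e2pi_ne_one β hβ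
  obtain ⟨C, hC, hCb⟩ := norm_bound _ hb hb1
  have hre : ∀ n : ℕ, 0 < (((n+1 : ℕ) : ℂ) * x).re := by
    intro n
    rw [← Complex.ofReal_natCast, Complex.re_ofReal_mul]
    positivity
  set F : ℕ → ℝ → ℂ := fun n t => (e2pi α ^ (n+1) / ((n+1 : ℕ) : ℂ) ^ (m+1)) *
    (Complex.exp (-(((n+1 : ℕ) : ℂ) * x) * t) / (1 - Complex.exp (-(t:ℂ)) * e2pi β)) with hF
  have key := hasSum_integral_of_summable_integral_norm (μ := volume.restrict (Set.Ioi (0:ℝ)))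
    (F := F) (fun n => (JJ_integrable _ _ (hre n) hb hb1).const_mul _) ?_
  · have e1 : (∫ t in Set.Ioi (0:ℝ), ∑' n, F n t) = HHZN (m+2) x α β := by
      unfold HHZN
      apply setIntegral_congr_fun measurableSet_Ioi
      intro t ht
      have hz : ‖Complex.exp (-x * t) * e2pi α‖ < 1 := by
        rw [norm_mul, e2pi_norm, mul_one, Complex.norm_exp]
        simp only [Real.exp_lt_one_iff]
        simp
        exact mul_pos hx ht
      have := ((Li_hasSum m _ hz).div_const (1 - Complex.exp (-(t:ℂ)) * e2pi β)).tsum_eq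
      show _ = Li (m+1) _ / _
      rw [← this]
      apply tsum_congr
      intro n
      simp only [hF]
      have he : Complex.exp (-(((n+1 : ℕ) : ℂ) * x) * t) = Complex.exp (-x * t) ^ (n+1) := by
        rw [← Complex.exp_nat_mul]; ring_nf
      rw [he, mul_pow]
      ring
    rw [e1] at key
    have e2 : (fun n : ℕ => e2pi α ^ (n+1) / ((n+1 : ℕ) : ℂ) ^ (m+1) *
      JJ (((n+1 : ℕ) : ℂ) * x) (e2pi β)) = fun n => ∫ t in Set.Ioi (0:ℝ), F n t := by
      funext n
      simp only [hF, JJ]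
      rw [MeasureTheory.integral_const_mul]
    rw [e2]
    exact key
  · apply Summable.of_nonneg_of_le (fun n => integral_nonneg fun _ => norm_nonneg _) _
      (summable_aux m (C / x.re))
    intro n
    simp only [hF, norm_mul]
    rw [MeasureTheory.integral_const_mul]
    have h1 := (hCb _ (hre n)).1
    have h2 : ‖e2pi α ^ (n+1) / ((n+1 : ℕ) : ℂ) ^ (m+1)‖ = 1 / ((n+1 : ℕ) : ℝ) ^ (m+1) := by
      rw [norm_div, norm_pow, norm_pow, Complex.norm_natCast, e2pi_norm, one_pow]
    have h3 : (((n+1 : ℕ) : ℂ) * x).re = ((n+1 : ℕ) : ℝ) * x.re := by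
      rw [← Complex.ofReal_natCast, Complex.re_ofReal_mul]
    rw [h2]
    refine (mul_le_mul_of_nonneg_left h1 (by positivity)).trans (le_of_eq ?_)
    rw [h3]
    field_simp
    ring

theorem dir_range (a : ℂ) (ha : ‖a‖ = 1) (φ : ℕ → ℝ) (hφ : Antitone φ) (h0 : ∀ n, 0 ≤ φ n)
    (n : ℕ) :
    ‖(1 - a) * ∑ i ∈ Finset.range n, a ^ i * (φ i : ℂ)‖ ≤ 2 * φ 0 := by
  have key : ∀ n : ℕ, ‖(1 - a) * ∑ i ∈ Finset.range n, a ^ i * (φ i : ℂ) + a ^ n * (φ n : ℂ)‖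
      ≤ 2 * φ 0 - φ n := by
    intro n
    induction n with
    | zero => simp [abs_of_nonneg (h0 0)]; linarith
    | succ n ih =>
      have e : (1 - a) * ∑ i ∈ Finset.range (n+1), a ^ i * (φ i : ℂ) + a ^ (n+1) * (φ (n+1) : ℂ)
        = ((1 - a) * ∑ i ∈ Finset.range n, a ^ i * (φ i : ℂ) + a ^ n * (φ n : ℂ))
          - a ^ (n+1) * ((φ n - φ (n+1) : ℝ) : ℂ) := by
        rw [Finset.sum_range_succ]; push_cast; ring
      rw [e]
      refine (norm_sub_le _ _).trans ?_
      have : ‖a ^ (n+1) * ((φ n - φ (n+1) : ℝ) : ℂ)‖ = φ n - φ (n+1) := by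
        rw [norm_mul, norm_pow, ha, one_pow, one_mul, Complex.norm_real, Real.norm_of_nonneg]
        linarith [hφ (Nat.le_succ n)]
      rw [this]; linarith
  have h1 := key n
  have h2 : ‖a ^ n * (φ n : ℂ)‖ = φ n := by
    rw [norm_mul, norm_pow, ha, one_pow, one_mul, Complex.norm_real, Real.norm_of_nonneg (h0 n)]
  have h3 := norm_sub_le ((1 - a) * ∑ i ∈ Finset.range n, a ^ i * (φ i : ℂ) + a ^ n * (φ n : ℂ))
    (a ^ n * (φ n : ℂ))
  rw [add_sub_cancel_right, h2] at h3
  linarith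

theorem dir_Ico (a : ℂ) (ha : ‖a‖ = 1) (ha1 : a ≠ 1) (s M N : ℕ) :
    ‖∑ q ∈ Finset.Ico (M+1) N, a ^ q / ((q : ℕ) : ℂ) ^ s‖ ≤
      2 / ‖1 - a‖ / ((M+1 : ℕ) : ℝ) ^ s := by
  have hpos : 0 < ‖1 - a‖ := norm_pos_iff.mpr (sub_ne_zero.mpr ha1.symm)
  have h := dir_range a ha (fun i => 1 / ((M+1+i : ℕ) : ℝ) ^ s) ?_ (fun n => by positivity)
    (N - (M+1))
  · have e : ∑ q ∈ Finset.Ico (M+1) N, a ^ q / ((q : ℕ) : ℂ) ^ s = a ^ (M+1) *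
      ∑ i ∈ Finset.range (N - (M+1)), a ^ i * ((1 / ((M+1+i : ℕ) : ℝ) ^ s : ℝ) : ℂ) := by
      rw [Finset.sum_Ico_eq_sum_range, Finset.mul_sum]
      apply Finset.sum_congr rfl
      intro i _
      push_cast
      rw [pow_add]
      ring
    rw [e, norm_mul, norm_pow, ha, one_pow, one_mul]
    rw [norm_mul] at h
    rw [div_div, le_div_iff₀ (by positivity)]
    simp only [add_zero] at h
    rw [mul_one_div, le_div_iff₀ (by positivity)] at h
    linarith
  · intro i k hik
    apply one_div_le_one_div_of_le (by positivity)
    gcongr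

theorem Icc_eq_Ico (M N : ℕ) : Finset.Icc M N = Finset.Ico M (N+1) := by
  ext; simp

theorem dir_tendsto (a : ℂ) (ha : ‖a‖ = 1) (ha1 : a ≠ 1) (s M : ℕ) :
    ∃ L, Tendsto (fun N : ℕ => ∑ q ∈ Finset.Icc M N, a ^ q / ((q : ℕ) : ℂ) ^ (s+1)) atTop (𝓝 L) := by
  have hpos : 0 < ‖1 - a‖ := norm_pos_iff.mpr (sub_ne_zero.mpr ha1.symm)
  set T : ℕ → ℂ := fun n => ∑ q ∈ Finset.range (n+1), a ^ q / ((q : ℕ) : ℂ) ^ (s+1) with hT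
  have hd : ∀ N n, N ≤ n → dist (T n) (T N) ≤ 2 / ‖1 - a‖ / ((N:ℝ)+1) := by
    intro N n h
    rw [dist_eq_norm, hT]
    simp only
    rw [← Finset.sum_Ico_eq_sub _ (by omega : N+1 ≤ n+1)]
    refine (dir_Ico a ha ha1 (s+1) N (n+1)).trans ?_
    apply div_le_div_of_nonneg_left (by positivity) (by positivity)
    push_cast
    apply le_self_pow₀ _ (by omega)
    linarith [Nat.cast_nonneg (α := ℝ) N]
  have hc : CauchySeq T := by
    apply cauchySeq_of_le_tendsto_0 (fun N : ℕ => 2 * (2 / ‖1 - a‖ / ((N:ℝ)+1)))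
    · intro n m N hn hm
      have := dist_triangle_right (T n) (T m) (T N)
      linarith [hd N n hn, hd N m hm]
    · have h1 : Tendsto (fun N : ℕ => 1 / ((N:ℝ)+1)) atTop (𝓝 0) :=
        tendsto_one_div_add_atTop_nhds_zero_nat
      have := h1.const_mul (2 * (2 / ‖1 - a‖))
      rw [mul_zero] at this
      refine this.congr fun N => ?_
      ring
  obtain ⟨L, hL⟩ := cauchySeq_tendsto_of_complete hc
  refine ⟨L - ∑ q ∈ Finset.range M, a ^ q / ((q : ℕ) : ℂ) ^ (s+1), ?_⟩
  refine (hL.sub_const _).congr' ?_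
  filter_upwards [eventually_ge_atTop M] with N hN
  rw [Icc_eq_Ico, Finset.sum_Ico_eq_sub _ (by omega : M ≤ N+1)]

theorem tsum_fin (c : ℕ → ℂ) (f : ℕ → ℕ → ℂ) (N : ℕ) :
    ∑' p : ℕ, c p * ∑ q ∈ Finset.Icc (p+2) N, f p q =
      ∑ p ∈ Finset.range N, c p * ∑ q ∈ Finset.Icc (p+2) N, f p q := by
  apply tsum_eq_sum
  intro p hp
  rw [Finset.Icc_eq_empty, Finset.sum_empty, mul_zero]
  simp at hp
  omega

theorem Li2_tendsto (a b : ℂ) (ha : ‖a‖ = 1) (ha1 : a ≠ 1) (hb : ‖b‖ = 1) (r s : ℕ) :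
    Tendsto (fun N : ℕ => ∑ p ∈ Finset.range N, (b ^ (p+1) / ((p+1 : ℕ) : ℂ) ^ (r+1)) *
      ∑ q ∈ Finset.Icc (p+2) N, a ^ q / ((q : ℕ) : ℂ) ^ (s+1)) atTop
      (𝓝 (Li2 (r+1) (s+1) b a)) := by
  have hpos : 0 < ‖1 - a‖ := norm_pos_iff.mpr (sub_ne_zero.mpr ha1.symm)
  have h := tendsto_tsum_of_dominated_convergence (𝓕 := atTop)
    (f := fun N p : ℕ => (b ^ (p+1) / ((p+1 : ℕ) : ℂ) ^ (r+1)) *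
      ∑ q ∈ Finset.Icc (p+2) N, a ^ q / ((q : ℕ) : ℂ) ^ (s+1))
    (g := fun p : ℕ => (b ^ (p+1) / ((p+1 : ℕ) : ℂ) ^ (r+1)) *
      limUnder atTop (fun N : ℕ => ∑ q ∈ Finset.Icc (p+2) N, a ^ q / ((q : ℕ) : ℂ) ^ (s+1)))
    (summable_aux 0 (2 / ‖1 - a‖)) ?_ ?_
  · refine h.congr fun N => ?_
    exact tsum_fin _ (fun _ q => a ^ q / ((q : ℕ) : ℂ) ^ (s+1)) N
  · intro p
    obtain ⟨L, hL⟩ := dir_tendsto a ha ha1 s (p+2)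
    rw [hL.limUnder_eq]
    exact hL.const_mul _
  · refine Eventually.of_forall fun N p => ?_
    rw [norm_mul, norm_div, norm_pow, norm_pow, hb, one_pow, Complex.norm_natCast, Icc_eq_Ico]
    have h1 := dir_Ico a ha ha1 (s+1) (p+1) (N+1)
    have h3 : (1:ℝ) ≤ ((p+1 : ℕ) : ℝ) := by push_cast; linarith [Nat.cast_nonneg (α := ℝ) p]
    have h2 : 2 / ‖1 - a‖ / ((p+1+1 : ℕ) : ℝ) ^ (s+1) ≤ 2 / ‖1 - a‖ / ((p+1 : ℕ) : ℝ) := by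
      apply div_le_div_of_nonneg_left (by positivity) (by positivity)
      calc ((p+1 : ℕ) : ℝ) ≤ ((p+1+1 : ℕ) : ℝ) := by push_cast; linarith
        _ ≤ _ := le_self_pow₀ (by push_cast at *; linarith) (by omega)
    have h4 : 1 / ((p+1 : ℕ) : ℝ) ^ (r+1) ≤ 1 / ((p+1 : ℕ) : ℝ) := by
      apply one_div_le_one_div_of_le (by positivity)
      exact le_self_pow₀ h3 (by omega)
    calc _ ≤ 1 / ((p+1 : ℕ) : ℝ) * (2 / ‖1 - a‖ / ((p+1 : ℕ) : ℝ)) :=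
          mul_le_mul h4 (h1.trans h2) (norm_nonneg _) (by positivity)
      _ = _ := by rw [zero_add]; field_simp

theorem R_tendsto (a b v : ℂ) (ha : ‖a‖ = 1) (ha1 : a ≠ 1) (hb : ‖b‖ = 1) (hv : 0 < v.re) (j : ℕ) :
    Tendsto (fun N : ℕ => ∑ p ∈ Finset.range N, (b ^ (p+1) / ((p+1 : ℕ) : ℂ) ^ (j+1)) *
      ∑ q ∈ Finset.Icc (p+2) N, a ^ q / ((q : ℂ) + ((p+1 : ℕ) : ℂ) * v)) atTop
      (𝓝 (∑' p : ℕ, (b ^ (p+1) / ((p+1 : ℕ) : ℂ) ^ (j+1)) *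
        (a ^ (p+2) * JJ (((p+1 : ℕ) : ℂ) * v + (p+2 : ℕ)) a))) := by
  obtain ⟨C, hC, hCb⟩ := norm_bound a ha ha1
  have hre : ∀ p n : ℕ, (((p+1 : ℕ) : ℂ) * v + (n : ℂ)).re = ((p+1 : ℕ) : ℝ) * v.re + n := by
    intro p n
    rw [Complex.add_re, ← Complex.ofReal_natCast, Complex.re_ofReal_mul, Complex.natCast_re]
  have hrepos : ∀ p n : ℕ, 0 < (((p+1 : ℕ) : ℂ) * v + (n : ℂ)).re := by
    intro p n
    rw [hre]; positivity
  have hsum : ∀ p N : ℕ, p + 1 ≤ N →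
      ∑ q ∈ Finset.Icc (p+2) N, a ^ q / ((q : ℂ) + ((p+1 : ℕ) : ℂ) * v) =
      a ^ (p+2) * JJ (((p+1 : ℕ) : ℂ) * v + (p+2 : ℕ)) a
        - a ^ (N+1) * JJ (((p+1 : ℕ) : ℂ) * v + (N+1 : ℕ)) a := by
    intro p N h
    obtain ⟨n, rfl⟩ := Nat.exists_eq_add_of_le h
    rw [JJ_sum (((p+1 : ℕ) : ℂ) * v + (p+2 : ℕ)) a (hrepos _ _) ha ha1 n, Icc_eq_Ico,
      Finset.sum_Ico_eq_sum_range]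
    have e1 : p + 1 + n + 1 - (p + 2) = n := by omega
    have e2 : ((p+1 : ℕ) : ℂ) * v + (p+2 : ℕ) + n = ((p+1 : ℕ) : ℂ) * v + (p+1+n+1 : ℕ) := by
      push_cast; ring
    rw [e1, e2, mul_add, Finset.mul_sum, ← mul_assoc, ← pow_add,
      show p + 2 + n = p + 1 + n + 1 by omega, add_sub_cancel_right]
    apply Finset.sum_congr rfl
    intro i _
    rw [pow_add a (p+2) i, mul_div_assoc]
    push_cast
    ring_nf
  have hJ : ∀ p n : ℕ, ‖JJ (((p+1 : ℕ) : ℂ) * v + (n : ℂ)) a‖ ≤ C / (((p+1 : ℕ) : ℝ) * v.re) := by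
    intro p n
    refine (hCb _ (hrepos p n)).2.trans ?_
    rw [hre]
    apply div_le_div_of_nonneg_left hC.le (by positivity)
    linarith [Nat.cast_nonneg (α := ℝ) n]
  have h := tendsto_tsum_of_dominated_convergence (𝓕 := atTop)
    (f := fun N p : ℕ => (b ^ (p+1) / ((p+1 : ℕ) : ℂ) ^ (j+1)) *
      ∑ q ∈ Finset.Icc (p+2) N, a ^ q / ((q : ℂ) + ((p+1 : ℕ) : ℂ) * v))
    (g := fun p : ℕ => (b ^ (p+1) / ((p+1 : ℕ) : ℂ) ^ (j+1)) *
      (a ^ (p+2) * JJ (((p+1 : ℕ) : ℂ) * v + (p+2 : ℕ)) a))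
    (summable_aux j (2 * C / v.re)) ?_ ?_
  · refine h.congr fun N => ?_
    exact tsum_fin _ (fun p q => a ^ q / ((q : ℂ) + ((p+1 : ℕ) : ℂ) * v)) N
  · intro p
    apply Tendsto.const_mul
    have hz : Tendsto (fun N : ℕ => a ^ (N+1) * JJ (((p+1 : ℕ) : ℂ) * v + (N+1 : ℕ)) a) atTop
        (𝓝 0) := by
      have h1 : Tendsto (fun N : ℕ => C * (1 / ((N:ℝ)+1))) atTop (𝓝 0) := by
        simpa using (tendsto_one_div_add_atTop_nhds_zero_nat (𝕜 := ℝ)).const_mul C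
      apply squeeze_zero_norm _ h1
      intro N
      rw [norm_mul, norm_pow, ha, one_pow, one_mul, mul_one_div]
      refine (hCb _ (hrepos p (N+1))).2.trans ?_
      rw [hre]
      apply div_le_div_of_nonneg_left hC.le (by positivity)
      push_cast
      have : 0 ≤ ((p:ℝ)+1) * v.re := by positivity
      linarith
    have := (tendsto_const_nhds (x := a ^ (p+2) * JJ (((p+1 : ℕ) : ℂ) * v + (p+2 : ℕ)) a)).sub hz
    rw [sub_zero] at this
    refine this.congr' ?_
    filter_upwards [eventually_ge_atTop (p+1)] with N hN
    rw [hsum p N hN]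
  · refine Eventually.of_forall fun N p => ?_
    rw [norm_mul, norm_div, norm_pow, norm_pow, hb, one_pow, Complex.norm_natCast]
    have h1 : ‖∑ q ∈ Finset.Icc (p+2) N, a ^ q / ((q : ℂ) + ((p+1 : ℕ) : ℂ) * v)‖ ≤
        2 * (C / (((p+1 : ℕ) : ℝ) * v.re)) := by
      by_cases hN : p + 1 ≤ N
      · rw [hsum p N hN]
        refine (norm_sub_le _ _).trans ?_
        rw [norm_mul, norm_mul, norm_pow, norm_pow, ha, one_pow, one_pow, one_mul, one_mul]
        linarith [hJ p (p+2), hJ p (N+1)]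
      · rw [Finset.Icc_eq_empty (by omega), Finset.sum_empty, norm_zero]
        positivity
    refine (mul_le_mul_of_nonneg_left h1 (by positivity)).trans (le_of_eq ?_)
    field_simp
    ring

theorem term_id (a b x : ℂ) (hx : 0 < x.re) (j p q : ℕ) (hq : 0 < q) :
    a ^ q / (q : ℂ) ^ (j+1) * (b ^ (p+1) / ((q : ℂ) * x + ((p+1 : ℕ) : ℂ))) +
      (-x) ^ j * (b ^ (p+1) / ((p+1 : ℕ) : ℂ) ^ (j+1) *
        (a ^ q / ((q : ℂ) + ((p+1 : ℕ) : ℂ) * x⁻¹))) =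
    ∑ i ∈ Finset.range (j+1), (-x) ^ i * (b ^ (p+1) / ((p+1 : ℕ) : ℂ) ^ (i+1) *
      (a ^ q / (q : ℂ) ^ (j - i + 1))) := by
  have hP : ((p+1 : ℕ) : ℂ) ≠ 0 := by exact_mod_cast Nat.succ_ne_zero p
  have hQ : (q : ℂ) ≠ 0 := by exact_mod_cast hq.ne'
  have hx0 : x ≠ 0 := by rintro rfl; simp at hx
  have hD : (q : ℂ) * x + ((p+1 : ℕ) : ℂ) ≠ 0 := by
    intro h
    have h2 := congrArg Complex.re h
    rw [Complex.add_re, ← Complex.ofReal_natCast q, Complex.re_ofReal_mul, Complex.natCast_re,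
      Complex.zero_re] at h2
    have : 0 < (q:ℝ) * x.re + ((p+1 : ℕ) : ℝ) := by positivity
    linarith
  generalize ((p+1 : ℕ) : ℂ) = P at *
  generalize (q : ℂ) = Q at *
  generalize b ^ (p+1) = B
  generalize a ^ q = A
  have hg := (Commute.all (-(x*Q)) P).mul_geom_sum₂ (j+1)
  have e : ∑ i ∈ Finset.range (j+1), (-x) ^ i * (B / P ^ (i+1) * (A / Q ^ (j - i + 1))) =
      A * B / (P ^ (j+1) * Q ^ (j+1)) *
        ∑ i ∈ Finset.range (j+1), (-(x*Q)) ^ i * P ^ (j+1-1-i) := by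
    rw [Finset.mul_sum]
    apply Finset.sum_congr rfl
    intro i hi
    obtain ⟨d, rfl⟩ := Nat.exists_eq_add_of_le (Nat.lt_succ_iff.mp (Finset.mem_range.mp hi))
    rw [show i + d - i = d by omega, show i + d + 1 - 1 - i = d by omega, ← neg_mul, mul_pow]
    field_simp
    ring
  have hD2 : Q + P * x⁻¹ ≠ 0 := by
    have : Q + P * x⁻¹ = (Q * x + P) * x⁻¹ := by field_simp
    rw [this]; exact mul_ne_zero hD (inv_ne_zero hx0)
  have e3 : A / (Q + P * x⁻¹) = A * x / (Q * x + P) := by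
    rw [div_eq_div_iff hD2 hD]; field_simp
  rw [e, e3]
  have hD3 : -(x*Q) - P ≠ 0 := by
    intro h; apply hD; linear_combination -h
  have e4 : ∑ i ∈ Finset.range (j+1), (-(x*Q)) ^ i * P ^ (j+1-1-i) =
      ((-(x*Q)) ^ (j+1) - P ^ (j+1)) / (-(x*Q) - P) := by
    rw [eq_div_iff hD3, ← hg]; ring
  have e5 : (-(x*Q)) ^ (j+1) = (-x)^j * (-x) * Q^(j+1) := by
    rw [← neg_mul, mul_pow, pow_succ (-x)]
  rw [e4, e5]
  have e6 : -(x*Q) - P = -(Q * x + P) := by ring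
  rw [e6]
  generalize (-x)^j = X
  field_simp
  ring

theorem swap_id (g : ℕ → ℕ → ℂ) (N : ℕ) :
    ∑ n ∈ Finset.range N, ∑ p ∈ Finset.range n, g p (n+1) =
      ∑ p ∈ Finset.range N, ∑ q ∈ Finset.Icc (p+2) N, g p q := by
  induction N with
  | zero => simp
  | succ N ih =>
    rw [Finset.sum_range_succ, ih, Finset.sum_range_succ _ N, Finset.Icc_eq_empty (by omega),
      Finset.sum_empty, add_zero, ← Finset.sum_add_distrib]
    apply Finset.sum_congr rfl
    intro p hp
    have := Finset.mem_range.mp hp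
    rw [Finset.sum_Icc_succ_top (by omega)]

theorem Li_hasSum_one (j : ℕ) (z : ℂ) (hz : ‖z‖ = 1) :
    HasSum (fun n : ℕ => z ^ (n+1) / ((n+1 : ℕ) : ℂ) ^ (j+2)) (Li (j+2) z) := by
  unfold Li
  apply Summable.hasSum
  apply Summable.of_norm_bounded (summable_aux j 1)
  intro n
  rw [norm_div, norm_pow, norm_pow, hz, one_pow, Complex.norm_natCast]

theorem part_one (j : ℕ) (x : ℂ) (hx : 0 < x.re) (α β : ℝ) (hβ : ∀ n : ℤ, β ≠ n) :
    Tendsto (fun N : ℕ => ∑ p ∈ Finset.range N, ∑ q ∈ Finset.Icc (p+2) N,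
      e2pi α ^ q / (q : ℂ) ^ (j+1) * (e2pi β ^ (p+1) / ((q : ℂ) * x + ((p+1 : ℕ) : ℂ)))) atTop
      (𝓝 (HHZN (j+2) x α β - HHZN (j+2) (x+1) (α+β) β - x⁻¹ * Li (j+2) (e2pi α))) := by
  have hb := e2pi_norm β
  have hb1 := e2pi_ne_one β hβ
  have hx1 : 0 < (x+1).re := by simp; linarith
  have hx0 : x ≠ 0 := by rintro rfl; simp at hx
  have h := (((HHZN_hasSum j x hx α β hβ).sub (HHZN_hasSum j (x+1) hx1 (α+β) β hβ)).sub
    ((Li_hasSum_one j _ (e2pi_norm α)).mul_left x⁻¹)).tendsto_sum_nat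
  refine h.congr fun N => ?_
  rw [← swap_id (fun p q => e2pi α ^ q / (q : ℂ) ^ (j+1) *
    (e2pi β ^ (p+1) / ((q : ℂ) * x + ((p+1 : ℕ) : ℂ))))]
  apply Finset.sum_congr rfl
  intro n _
  have hre : 0 < (((n+1 : ℕ) : ℂ) * x).re := by
    rw [← Complex.ofReal_natCast, Complex.re_ofReal_mul]
    positivity
  rw [JJ_sum _ _ hre hb hb1 (n+1), Finset.sum_range_succ', e2pi_add, ← Finset.mul_sum,
    show ((n+1 : ℕ) : ℂ) * (x+1) = ((n+1 : ℕ) : ℂ) * x + ((n+1 : ℕ) : ℂ) by ring]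
  have hn : ((n+1 : ℕ) : ℂ) ≠ 0 := by exact_mod_cast Nat.succ_ne_zero n
  generalize ((n+1 : ℕ) : ℂ) = Q at *
  generalize ∑ p ∈ Finset.range n, e2pi β ^ (p+1) / (Q * x + ((p+1 : ℕ) : ℂ)) = S
  generalize JJ (Q * x + Q) (e2pi β) = J
  rw [mul_pow]
  simp only [pow_zero, Nat.cast_zero, add_zero]
  have : x⁻¹ * (e2pi α ^ (n+1) / Q ^ (j+2)) = e2pi α ^ (n+1) / Q ^ (j+1) * (1 / (Q * x)) := by
    field_simp
    try ring
  rw [this]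
  ring

theorem part_two (j : ℕ) (x : ℂ) (hx : 0 < x.re) (α β : ℝ) (hα : ∀ n : ℤ, α ≠ n) :
    (∑' p : ℕ, (e2pi β ^ (p+1) / ((p+1 : ℕ) : ℂ) ^ (j+1)) *
        (e2pi α ^ (p+2) * JJ (((p+1 : ℕ) : ℂ) * x⁻¹ + (p+2 : ℕ)) (e2pi α))) =
    HHZN (j+2) ((x+1)/x) (α+β) α - x / (x+1) * Li (j+2) (e2pi (α+β)) := by
  have ha := e2pi_norm α
  have ha1 := e2pi_ne_one α hα
  have hx0 : x ≠ 0 := by rintro rfl; simp at hx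
  have hx1 : x + 1 ≠ 0 := by
    intro h
    have := congrArg Complex.re h
    simp at this
    linarith
  have hv : 0 < (x⁻¹).re := by
    rw [Complex.inv_re]
    exact div_pos hx (Complex.normSq_pos.mpr hx0)
  have hy : (x+1)/x = x⁻¹ + 1 := by field_simp; try ring
  have hyre : 0 < ((x+1)/x).re := by rw [hy]; simp only [Complex.add_re, Complex.one_re]; linarith
  have h := ((HHZN_hasSum j ((x+1)/x) hyre (α+β) α hα).sub
    ((Li_hasSum_one j _ (e2pi_norm (α+β))).mul_left (x/(x+1)))).tsum_eq
  rw [← h]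
  apply tsum_congr
  intro p
  have hre : 0 < (((p+1 : ℕ) : ℂ) * ((x+1)/x)).re := by
    rw [← Complex.ofReal_natCast, Complex.re_ofReal_mul]
    positivity
  rw [JJ_rec _ _ hre ha ha1]
  have e1 : ((p+1 : ℕ) : ℂ) * ((x+1)/x) + 1 = ((p+1 : ℕ) : ℂ) * x⁻¹ + (p+2 : ℕ) := by
    rw [hy]; push_cast; ring
  rw [e1, e2pi_add, mul_pow]
  have hn : ((p+1 : ℕ) : ℂ) ≠ 0 := by exact_mod_cast Nat.succ_ne_zero p
  generalize JJ (((p+1 : ℕ) : ℂ) * x⁻¹ + (p+2 : ℕ)) (e2pi α) = J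
  generalize ((p+1 : ℕ) : ℂ) = P at *
  have e2 : x / (x+1) * (e2pi α ^ (p+1) * e2pi β ^ (p+1) / P ^ (j+2)) =
    e2pi α ^ (p+1) * e2pi β ^ (p+1) / P ^ (j+1) * (1 / (P * ((x+1)/x))) := by
    field_simp
    try ring
  rw [e2]
  ring

/-- The three-term functional equation for the higher Herglotz–Zagier–Novikov function:
`𝓕_k(x;α,β) - 𝓕_k(x+1;α+β,β) + (-x)^{k-2} 𝓕_k((x+1)/x;α+β,α)
  = (1/x) Li_k(e^{2πiα}) - ((-x)^{k-1}/(x+1)) Li_k(e^{2πi(α+β)})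
    + ∑_{r=1}^{k-1} (-x)^{r-1} Li_{r,k-r}(e^{2πiβ}, e^{2πiα})`. -/
theorem HHZN_three_term_functional_equation (k : ℕ) (hk : 2 ≤ k) (α β : ℝ)
    (hα : ∀ n : ℤ, α ≠ n) (hβ : ∀ n : ℤ, β ≠ n) (x : ℂ) (hx : 0 < x.re) :
    HHZN k x α β - HHZN k (x + 1) (α + β) β + (-x) ^ (k - 2) * HHZN k ((x + 1) / x) (α + β) α
      = x⁻¹ * Li k (e2pi α) - (-x) ^ (k - 1) / (x + 1) * Li k (e2pi (α + β)) +
        ∑ r ∈ Finset.Icc 1 (k - 1),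
          (-x) ^ (r - 1) * Li2 r (k - r) (e2pi β) (e2pi α) := by
  obtain ⟨j, rfl⟩ := Nat.exists_eq_add_of_le hk
  rw [show 2 + j = j + 2 by omega]
  simp only [show j + 2 - 2 = j by omega, show j + 2 - 1 = j + 1 by omega]
  have ha := e2pi_norm α
  have ha1 := e2pi_ne_one α hα
  have hb := e2pi_norm β
  have hx0 : x ≠ 0 := by rintro rfl; simp at hx
  have hv : 0 < (x⁻¹).re := by
    rw [Complex.inv_re]
    exact div_pos hx (Complex.normSq_pos.mpr hx0)
  have h1 := part_one j x hx α β hβ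
  have h2 := R_tendsto (e2pi α) (e2pi β) x⁻¹ ha ha1 hb hv j
  rw [part_two j x hx α β hα] at h2
  have h12 := h1.add (h2.const_mul ((-x) ^ j))
  have h3 : Tendsto (fun N : ℕ => ∑ i ∈ Finset.range (j+1), (-x) ^ i *
      ∑ p ∈ Finset.range N, (e2pi β ^ (p+1) / ((p+1 : ℕ) : ℂ) ^ (i+1)) *
        ∑ q ∈ Finset.Icc (p+2) N, e2pi α ^ q / ((q : ℕ) : ℂ) ^ (j - i + 1)) atTop
      (𝓝 (∑ i ∈ Finset.range (j+1), (-x) ^ i * Li2 (i+1) (j - i + 1) (e2pi β) (e2pi α))) :=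
    tendsto_finsetSum _ fun i _ =>
      (Li2_tendsto (e2pi α) (e2pi β) ha ha1 hb i (j - i)).const_mul _
  have h4 := tendsto_nhds_unique (h3.congr fun N => ?_) h12
  · have e : ∑ r ∈ Finset.Icc 1 (j+1), (-x) ^ (r - 1) * Li2 r (j + 2 - r) (e2pi β) (e2pi α) =
        ∑ i ∈ Finset.range (j+1), (-x) ^ i * Li2 (i+1) (j - i + 1) (e2pi β) (e2pi α) := by
      rw [Icc_eq_Ico, Finset.sum_Ico_eq_sum_range]
      apply Finset.sum_congr (by simp)
      intro i hi
      have hi' : i < j + 1 := by simpa using hi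
      rw [show 1 + i - 1 = i by omega, show j + 2 - (1 + i) = j - i + 1 by omega, add_comm 1 i]
    rw [e, h4]
    rw [pow_succ]
    ring
  · rw [Finset.mul_sum, ← Finset.sum_add_distrib]
    simp only [Finset.mul_sum]
    rw [Finset.sum_comm]
    apply Finset.sum_congr rfl
    intro p _
    rw [Finset.sum_comm, ← Finset.sum_add_distrib]
    apply Finset.sum_congr rfl
    intro q hq
    have hq' := (Finset.mem_Icc.mp hq).1
    exact (term_id (e2pi α) (e2pi β) x hx j p q (by omega)).symm


end
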